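/- Let σ > 0, Δ > 0 and ε ≥ 0 be real numbers, let Φ denote the cumulative distribution function of the standard normal distribution, and set δ = Φ(−ε·σ/Δ + Δ/(2σ)) − e^ε·Φ(−ε·σ/Δ − Δ/(2σ)). Then for every Borel set A ⊆ ℝ, the Gaussian measures with variance σ² satisfy N(0, σ²)(A) ≤ e^ε · N(Δ, σ²)(A) + δ, and symmetrically N(Δ, σ²)(A) ≤ e^ε · N(0, σ²)(A) + δ. -/

import Mathlib

open MeasureTheory ProbabilityTheory

/-- The standard normal cumulative distribution function. -/
noncomputable def stdNormalCDF (x : ℝ) : ℝ :=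
  (gaussianReal 0 1 (Set.Iic x)).toReal

/-- The hockey-stick divergence bound: if `c • ν ≤ μ` on `S` and `μ ≤ c • ν` off `S`, then `S`
maximises `μ A - c * ν A`. -/
theorem measure_add_mul_le_of_le_on_of_le_off {α : Type*} [MeasurableSpace α] {μ ν : Measure α}
    {c : ENNReal} {S : Set α} (hS : MeasurableSet S)
    (hon : ∀ B, MeasurableSet B → B ⊆ S → c * ν B ≤ μ B)
    (hoff : ∀ B, MeasurableSet B → B ⊆ Sᶜ → μ B ≤ c * ν B)
    {A : Set α} (hA : MeasurableSet A) :
    μ A + c * ν S ≤ c * ν A + μ S := by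
  rw [← measure_inter_add_sdiff (μ := μ) A hS, ← measure_inter_add_sdiff (μ := ν) A hS,
    ← measure_inter_add_sdiff (μ := μ) S hA, ← measure_inter_add_sdiff (μ := ν) S hA,
    Set.inter_comm S A]
  calc μ (A ∩ S) + μ (A \ S) + c * (ν (A ∩ S) + ν (S \ A))
      ≤ μ (A ∩ S) + c * ν (A \ S) + (c * ν (A ∩ S) + μ (S \ A)) := by
        rw [mul_add]
        gcongr
        · exact hoff _ (hA.diff hS) fun x hx => hx.2
        · exact hon _ (hS.diff hA) Set.sdiff_subset
    _ = c * (ν (A ∩ S) + ν (A \ S)) + (μ (A ∩ S) + μ (S \ A)) := by ring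

theorem stdNormalCDF_nonneg (x : ℝ) : 0 ≤ stdNormalCDF x :=
  ENNReal.toReal_nonneg

theorem gaussianReal_Iic_eq_stdNormalCDF {σ : ℝ} (hσ : 0 < σ) (m t : ℝ) :
    gaussianReal m (σ ^ 2).toNNReal (Set.Iic t) = ENNReal.ofReal (stdNormalCDF ((t - m) / σ)) := by
  have hmap : gaussianReal m (σ ^ 2).toNNReal =
      ((gaussianReal 0 1).map (σ * ·)).map (· + m) := by
    rw [gaussianReal_map_const_mul, gaussianReal_map_add_const]
    congr 1
    · simp
    · ext
      simp [Real.coe_toNNReal _ (sq_nonneg σ)]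
  rw [hmap, Measure.map_map (by fun_prop) (by fun_prop),
    Measure.map_apply (by fun_prop) measurableSet_Iic, stdNormalCDF,
    ENNReal.ofReal_toReal (measure_ne_top _ _)]
  congr 1
  ext x
  simp only [Set.mem_preimage, Function.comp_apply, Set.mem_Iic]
  rw [le_div_iff₀ hσ, mul_comm σ x, le_sub_iff_add_le]

theorem exp_mul_gaussianPDFReal (ε m : ℝ) (v : NNReal) (x : ℝ) :
    Real.exp ε * gaussianPDFReal m v x =
      (√(2 * Real.pi * v))⁻¹ * Real.exp (ε - (x - m) ^ 2 / (2 * v)) := by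
  rw [gaussianPDFReal, sub_eq_add_neg ε, Real.exp_add, neg_div]
  ring

theorem gaussianReal_zero_le_exp_mul_add {σ Δ ε : ℝ} (hσ : 0 < σ) (hΔ : 0 < Δ)
    {A : Set ℝ} (hA : MeasurableSet A) :
    gaussianReal 0 (σ ^ 2).toNNReal A ≤
      ENNReal.ofReal (Real.exp ε) * gaussianReal Δ (σ ^ 2).toNNReal A +
        ENNReal.ofReal (stdNormalCDF (-(ε * σ) / Δ + Δ / (2 * σ)) -
          Real.exp ε * stdNormalCDF (-(ε * σ) / Δ - Δ / (2 * σ))) := by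
  have hv : (σ ^ 2).toNNReal ≠ 0 := by simpa using hσ.ne'
  have hvc : ((σ ^ 2).toNNReal : ℝ) = σ ^ 2 := Real.coe_toNNReal _ (sq_nonneg σ)
  set t : ℝ := Δ / 2 - σ ^ 2 * ε / Δ with ht
  have hexponent (x : ℝ) : -(x - 0) ^ 2 / (2 * σ ^ 2) - (ε - (x - Δ) ^ 2 / (2 * σ ^ 2)) =
      Δ / σ ^ 2 * (t - x) := by
    rw [ht]
    field_simp
    ring
  have hΔσ : 0 < Δ / σ ^ 2 := by positivity
  have hle {x : ℝ} (hx : x ≤ t) :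
      Real.exp ε * gaussianPDFReal Δ (σ ^ 2).toNNReal x ≤
        gaussianPDFReal 0 (σ ^ 2).toNNReal x := by
    rw [exp_mul_gaussianPDFReal, gaussianPDFReal, hvc]
    gcongr
    nlinarith [hexponent x, mul_nonneg hΔσ.le (sub_nonneg.2 hx)]
  have hge {x : ℝ} (hx : t ≤ x) :
      gaussianPDFReal 0 (σ ^ 2).toNNReal x ≤
        Real.exp ε * gaussianPDFReal Δ (σ ^ 2).toNNReal x := by
    rw [exp_mul_gaussianPDFReal, gaussianPDFReal, hvc]
    gcongr
    nlinarith [hexponent x, mul_nonneg hΔσ.le (sub_nonneg.2 hx)]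
  have hmul (B : Set ℝ) : ENNReal.ofReal (Real.exp ε) * gaussianReal Δ (σ ^ 2).toNNReal B =
      ∫⁻ x in B, ENNReal.ofReal (Real.exp ε * gaussianPDFReal Δ (σ ^ 2).toNNReal x) := by
    rw [gaussianReal_apply _ hv, ← lintegral_const_mul _ (measurable_gaussianPDF _ _)]
    simp only [gaussianPDF, ENNReal.ofReal_mul (Real.exp_pos ε).le]
  have key := measure_add_mul_le_of_le_on_of_le_off (μ := gaussianReal 0 (σ ^ 2).toNNReal)
    (ν := gaussianReal Δ (σ ^ 2).toNNReal) (c := ENNReal.ofReal (Real.exp ε))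
    (S := Set.Iic t) measurableSet_Iic
    (fun B hB hBS => by
      rw [hmul, gaussianReal_apply _ hv]
      exact setLIntegral_mono' hB fun x hx => ENNReal.ofReal_le_ofReal (hle (hBS hx)))
    (fun B hB hBS => by
      rw [hmul, gaussianReal_apply _ hv]
      exact setLIntegral_mono' hB fun x hx =>
        ENNReal.ofReal_le_ofReal (hge (Set.notMem_Iic.1 (hBS hx)).le))
    hA
  have h0 : (t - 0) / σ = -(ε * σ) / Δ + Δ / (2 * σ) := by
    rw [ht]
    field_simp
    ring
  have h1 : (t - Δ) / σ = -(ε * σ) / Δ - Δ / (2 * σ) := by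
    rw [ht]
    field_simp
    ring
  rw [gaussianReal_Iic_eq_stdNormalCDF hσ, gaussianReal_Iic_eq_stdNormalCDF hσ, h0, h1,
    ← ENNReal.ofReal_mul (Real.exp_pos ε).le] at key
  rw [ENNReal.ofReal_sub _ (mul_nonneg (Real.exp_pos ε).le (stdNormalCDF_nonneg _))]
  exact (ENNReal.le_sub_of_add_le_right ENNReal.ofReal_ne_top key).trans add_tsub_le_assoc

theorem gaussianReal_apply_eq_preimage_const_sub (Δ m : ℝ) (v : NNReal) {A : Set ℝ}
    (hA : MeasurableSet A) :
    gaussianReal (Δ - m) v A = gaussianReal m v ((Δ - ·) ⁻¹' A) := by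
  rw [← gaussianReal_map_const_sub, Measure.map_apply (by fun_prop) hA]

/-- The analytic Gaussian mechanism: two Gaussian measures with common variance `σ²`
and means `0` and `Δ` are `(ε, δ)`-indistinguishable with
`δ = Φ(−εσ/Δ + Δ/(2σ)) − e^ε·Φ(−εσ/Δ − Δ/(2σ))`. -/
theorem gaussian_mechanism_dp
    (σ Δ ε : ℝ) (hσ : 0 < σ) (hΔ : 0 < Δ) (hε : 0 ≤ ε)
    (δ : ℝ)
    (hδ : δ = stdNormalCDF (-(ε * σ) / Δ + Δ / (2 * σ)) -
        Real.exp ε * stdNormalCDF (-(ε * σ) / Δ - Δ / (2 * σ))) :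
    ∀ A : Set ℝ, MeasurableSet A →
      gaussianReal 0 (σ ^ 2).toNNReal A ≤
        ENNReal.ofReal (Real.exp ε) * gaussianReal Δ (σ ^ 2).toNNReal A +
          ENNReal.ofReal δ ∧
      gaussianReal Δ (σ ^ 2).toNNReal A ≤
        ENNReal.ofReal (Real.exp ε) * gaussianReal 0 (σ ^ 2).toNNReal A +
          ENNReal.ofReal δ := by
  intro A hA
  subst hδ
  refine ⟨gaussianReal_zero_le_exp_mul_add hσ hΔ hA, ?_⟩
  have h0 := gaussianReal_apply_eq_preimage_const_sub Δ 0 (σ ^ 2).toNNReal hA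
  have h1 := gaussianReal_apply_eq_preimage_const_sub Δ Δ (σ ^ 2).toNNReal hA
  rw [sub_zero] at h0
  rw [sub_self] at h1
  rw [h0, h1]
  exact gaussianReal_zero_le_exp_mul_add hσ hΔ (hA.preimage (by fun_prop))
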